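/- Let δ > 0 and let b0, b1, b2, b3 : {v : 0 < |v| < δ} → ℝ be functions such that for every v in the domain: N(v, b0(v), b1(v), b2(v), b3(v)) = 0 and all three partial derivatives (∂N/∂v), (∂²N/∂v²), (∂³N/∂v³) vanish at (v, b0(v), b1(v), b2(v), b3(v)). Then (b3(v) - 17671/12096)/v^2 → -45767/181440 as v → 0 with v ≠ 0; that is, the second-order Taylor coefficient at v = 0 of the b3-coefficient of the method with zero phase-lag and zero first, second and third derivatives of the phase-lag equals -45767/181440. -/

import Mathlib

/-- Phase-lag numerator of the symmetric 8-step method. -/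
noncomputable def N (v b0 b1 b2 b3 : ℝ) : ℝ :=
  16 * Real.cos v ^ 4 + (8 * b3 * v ^ 2 - 16) * Real.cos v ^ 3
    + (4 * b2 * v ^ 2 - 8) * Real.cos v ^ 2
    + (10 + (2 * b1 - 6 * b3) * v ^ 2) * Real.cos v - 2
    + (b0 - 2 * b2) * v ^ 2

open Real Filter Topology

/-- Peano form of the remainder: `f` differs from its Taylor polynomial by `x ^ n * ρ x`
with `ρ` continuous and vanishing at `0`. -/
theorem exists_taylor_remainder {f : ℝ → ℝ} {n : ℕ} (hn : n ≠ 0) (hf : ContDiff ℝ n f) :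
    ∃ ρ : ℝ → ℝ, Continuous ρ ∧ ρ 0 = 0 ∧
      ∀ x, f x = taylorWithinEval f n Set.univ 0 x + x ^ n * ρ x := by
  refine ⟨fun x => (f x - taylorWithinEval f n Set.univ 0 x) / x ^ n, ?_, by simp [hn],
    fun x => ?_⟩
  · refine continuous_iff_continuousAt.mpr fun x => ?_
    rcases eq_or_ne x 0 with rfl | hx
    · simpa [ContinuousAt, hn] using (taylor_isLittleO_univ (x₀ := 0) hf).tendsto_div_nhds_zero
    · have hf' := hf.continuous
      simp only [taylor_within_apply]
      fun_prop (disch := exact pow_ne_zero n hx)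
  · rcases eq_or_ne x 0 with rfl | hx
    · simp [hn]
    · field_simp
      ring

theorem exists_cos_remainder :
    ∃ ρ : ℝ → ℝ, Continuous ρ ∧ ρ 0 = 0 ∧
      ∀ x, cos x = 1 - x ^ 2 / 2 + x ^ 4 / 24 - x ^ 6 / 720 + x ^ 8 / 40320
        - x ^ 10 / 3628800 + x ^ 12 / 479001600 + x ^ 12 * ρ x := by
  obtain ⟨ρ, hρ, hρ0, h⟩ := exists_taylor_remainder (n := 12) (by norm_num) contDiff_cos
  refine ⟨ρ, hρ, hρ0, fun x => ?_⟩
  rw [h x, taylor_within_apply]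
  simp [Finset.sum_range_succ, iteratedDerivWithin_univ, Nat.factorial]
  ring

theorem exists_sin_remainder :
    ∃ σ : ℝ → ℝ, Continuous σ ∧ σ 0 = 0 ∧
      ∀ x, sin x = x - x ^ 3 / 6 + x ^ 5 / 120 - x ^ 7 / 5040 + x ^ 9 / 362880
        - x ^ 11 / 39916800 + x ^ 12 * σ x := by
  obtain ⟨σ, hσ, hσ0, h⟩ := exists_taylor_remainder (n := 12) (by norm_num) contDiff_sin
  refine ⟨σ, hσ, hσ0, fun x => ?_⟩
  rw [h x, taylor_within_apply]
  simp [Finset.sum_range_succ, iteratedDerivWithin_univ, Nat.factorial]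
  ring

theorem sin_cos_multiples (v : ℝ) :
    cos (2 * v) = 2 * cos v ^ 2 - 1 ∧ cos (3 * v) = 4 * cos v ^ 3 - 3 * cos v ∧
    cos (4 * v) = 8 * cos v ^ 4 - 8 * cos v ^ 2 + 1 ∧
    cos (5 * v) = 16 * cos v ^ 5 - 20 * cos v ^ 3 + 5 * cos v ∧
    cos (6 * v) = 32 * cos v ^ 6 - 48 * cos v ^ 4 + 18 * cos v ^ 2 - 1 ∧
    sin (2 * v) = sin v * (2 * cos v) ∧ sin (3 * v) = sin v * (4 * cos v ^ 2 - 1) ∧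
    sin (4 * v) = sin v * (8 * cos v ^ 3 - 4 * cos v) ∧
    sin (5 * v) = sin v * (16 * cos v ^ 4 - 12 * cos v ^ 2 + 1) ∧
    sin (6 * v) = sin v * (32 * cos v ^ 5 - 32 * cos v ^ 3 + 6 * cos v) := by
  have h := sin_sq_add_cos_sq v
  have c2 : cos (2 * v) = 2 * cos v ^ 2 - 1 := cos_two_mul v
  have s2 : sin (2 * v) = sin v * (2 * cos v) := by rw [sin_two_mul]; ring
  have c3 : cos (3 * v) = 4 * cos v ^ 3 - 3 * cos v := cos_three_mul v
  have s3 : sin (3 * v) = sin v * (4 * cos v ^ 2 - 1) := by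
    rw [sin_three_mul]; linear_combination -4 * sin v * h
  have c4 : cos (4 * v) = 8 * cos v ^ 4 - 8 * cos v ^ 2 + 1 := by
    rw [show 4 * v = 2 * (2 * v) by ring, cos_two_mul, c2]; ring
  have s4 : sin (4 * v) = sin v * (8 * cos v ^ 3 - 4 * cos v) := by
    rw [show 4 * v = 2 * (2 * v) by ring, sin_two_mul, c2, s2]; ring
  refine ⟨c2, c3, c4, ?_, ?_, s2, s3, s4, ?_, ?_⟩
  · rw [show 5 * v = 4 * v + v by ring, cos_add, c4, s4]
    linear_combination (-(8 * cos v ^ 3 - 4 * cos v)) * h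
  · rw [show 6 * v = 2 * (3 * v) by ring, cos_two_mul, c3]; ring
  · rw [show 5 * v = 4 * v + v by ring, sin_add, c4, s4]; ring
  · rw [show 6 * v = 2 * (3 * v) by ring, sin_two_mul, c3, s3]; ring

theorem N_eq_cos_multiples (v b0 b1 b2 b3 : ℝ) :
    N v b0 b1 b2 b3 = 2 * cos (4 * v) - 4 * cos (3 * v) + 4 * cos (2 * v) - 2 * cos v
      + v ^ 2 * (2 * b3 * cos (3 * v) + 2 * b2 * cos (2 * v) + 2 * b1 * cos v + b0) := by
  obtain ⟨c2, c3, c4, -⟩ := sin_cos_multiples v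
  rw [N, c2, c3, c4]
  ring

theorem iteratedDeriv_three_of_hasDerivAt {f f₁ f₂ f₃ : ℝ → ℝ}
    (h₁ : ∀ x, HasDerivAt f (f₁ x) x) (h₂ : ∀ x, HasDerivAt f₁ (f₂ x) x)
    (h₃ : ∀ x, HasDerivAt f₂ (f₃ x) x) :
    deriv f = f₁ ∧ iteratedDeriv 2 f = f₂ ∧ iteratedDeriv 3 f = f₃ := by
  have e₁ : deriv f = f₁ := funext fun x => (h₁ x).deriv
  have e₂ : iteratedDeriv 2 f = f₂ := by
    rw [iteratedDeriv_succ, iteratedDeriv_one, e₁]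
    exact funext fun x => (h₂ x).deriv
  refine ⟨e₁, e₂, ?_⟩
  rw [iteratedDeriv_succ, e₂]
  exact funext fun x => (h₃ x).deriv

theorem hasDerivAt_cos_const_mul (k x : ℝ) :
    HasDerivAt (fun x => cos (k * x)) (-(k * sin (k * x))) x := by
  have h := ((hasDerivAt_id x).const_mul k).cos
  simp only [id, mul_one] at h
  convert h using 1
  ring

theorem hasDerivAt_sin_const_mul (k x : ℝ) :
    HasDerivAt (fun x => sin (k * x)) (k * cos (k * x)) x := by
  have h := ((hasDerivAt_id x).const_mul k).sin
  simp only [id, mul_one] at h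
  convert h using 1
  ring

/-- A trigonometric sum with frequencies `1, 2, 3, 4`, together with its first three derivatives. -/
theorem hasDerivAt_trig_sum (a b c d e x : ℝ) :
    HasDerivAt (fun x => a * cos (4 * x) + b * cos (3 * x) + c * cos (2 * x) + d * cos x + e)
      (-(4 * a * sin (4 * x) + 3 * b * sin (3 * x) + 2 * c * sin (2 * x) + d * sin x)) x ∧
    HasDerivAt
      (fun x => -(4 * a * sin (4 * x) + 3 * b * sin (3 * x) + 2 * c * sin (2 * x) + d * sin x))
      (-(16 * a * cos (4 * x) + 9 * b * cos (3 * x) + 4 * c * cos (2 * x) + d * cos x)) x ∧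
    HasDerivAt
      (fun x => -(16 * a * cos (4 * x) + 9 * b * cos (3 * x) + 4 * c * cos (2 * x) + d * cos x))
      (64 * a * sin (4 * x) + 27 * b * sin (3 * x) + 8 * c * sin (2 * x) + d * sin x) x := by
  have hc := fun k => hasDerivAt_cos_const_mul k x
  have hs := fun k => hasDerivAt_sin_const_mul k x
  refine ⟨?_, ?_, ?_⟩
  · refine HasDerivAt.congr_deriv ((((((hc 4).const_mul a).fun_add
      ((hc 3).const_mul b)).fun_add ((hc 2).const_mul c)).fun_add
      ((hasDerivAt_cos x).const_mul d)).add_const e) ?_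
    ring
  · refine HasDerivAt.congr_deriv ((((((hs 4).const_mul (4 * a)).fun_add
      ((hs 3).const_mul (3 * b))).fun_add ((hs 2).const_mul (2 * c))).fun_add
      ((hasDerivAt_sin x).const_mul d)).fun_neg) ?_
    ring
  · refine HasDerivAt.congr_deriv ((((((hc 4).const_mul (16 * a)).fun_add
      ((hc 3).const_mul (9 * b))).fun_add ((hc 2).const_mul (4 * c))).fun_add
      ((hasDerivAt_cos x).const_mul d)).fun_neg) ?_
    ring

theorem iteratedDeriv_add_sq_mul {f f₁ f₂ f₃ g g₁ g₂ g₃ : ℝ → ℝ}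
    (hf₁ : ∀ x, HasDerivAt f (f₁ x) x) (hf₂ : ∀ x, HasDerivAt f₁ (f₂ x) x)
    (hf₃ : ∀ x, HasDerivAt f₂ (f₃ x) x)
    (hg₁ : ∀ x, HasDerivAt g (g₁ x) x) (hg₂ : ∀ x, HasDerivAt g₁ (g₂ x) x)
    (hg₃ : ∀ x, HasDerivAt g₂ (g₃ x) x) :
    deriv (fun x => f x + x ^ 2 * g x) = (fun x => f₁ x + 2 * x * g x + x ^ 2 * g₁ x) ∧
    iteratedDeriv 2 (fun x => f x + x ^ 2 * g x) =
      (fun x => f₂ x + 2 * g x + 4 * x * g₁ x + x ^ 2 * g₂ x) ∧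
    iteratedDeriv 3 (fun x => f x + x ^ 2 * g x) =
      (fun x => f₃ x + 6 * g₁ x + 6 * x * g₂ x + x ^ 2 * g₃ x) := by
  have hq : ∀ x : ℝ, HasDerivAt (fun x : ℝ => x ^ 2) (2 * x) x := fun x => by
    simpa using hasDerivAt_pow 2 x
  have hl : ∀ k x : ℝ, HasDerivAt (fun x : ℝ => k * x) k x := fun k x => by
    simpa using (hasDerivAt_id x).const_mul k
  refine iteratedDeriv_three_of_hasDerivAt (fun x => ?_) (fun x => ?_) (fun x => ?_)
  · refine HasDerivAt.congr_deriv ((hf₁ x).fun_add ((hq x).fun_mul (hg₁ x))) ?_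
    ring
  · refine HasDerivAt.congr_deriv (((hf₂ x).fun_add ((hl 2 x).fun_mul (hg₁ x))).fun_add
      ((hq x).fun_mul (hg₂ x))) ?_
    ring
  · refine HasDerivAt.congr_deriv ((((hf₃ x).fun_add ((hg₁ x).const_mul 2)).fun_add
      ((hl 4 x).fun_mul (hg₂ x))).fun_add ((hq x).fun_mul (hg₃ x))) ?_
    ring

/-- Eliminating `b0`, `b1`, `b2` from the four phase-lag conditions. -/
theorem b3_sub_mul_eq_trig_sum {v b0 b1 b2 b3 : ℝ}
    (h₀ : N v b0 b1 b2 b3 = 0) (h₁ : deriv (fun w => N w b0 b1 b2 b3) v = 0)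
    (h₂ : iteratedDeriv 2 (fun w => N w b0 b1 b2 b3) v = 0)
    (h₃ : iteratedDeriv 3 (fun w => N w b0 b1 b2 b3) v = 0) :
    48 * (b3 - 17671 / 12096) * v ^ 5 * sin v ^ 5 =
      24 - 12 * cos v - 36 * cos (2 * v) + 36 * cos (3 * v) - 24 * cos (5 * v)
      + 12 * cos (6 * v) - 36 * v * sin v - 27 * v * sin (2 * v) + 108 * v * sin (3 * v)
      - 54 * v * sin (4 * v) - 36 * v * sin (5 * v) + 27 * v * sin (6 * v) - 52 * v ^ 2
      + 107 * v ^ 2 * cos v - 42 * v ^ 2 * cos (2 * v) - 93 * v ^ 2 * cos (3 * v)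
      + 84 * v ^ 2 * cos (4 * v) + 22 * v ^ 2 * cos (5 * v) - 26 * v ^ 2 * cos (6 * v)
      + 60 * v ^ 3 * sin v - 60 * v ^ 3 * sin (2 * v) - 30 * v ^ 3 * sin (3 * v)
      + 48 * v ^ 3 * sin (4 * v) + 6 * v ^ 3 * sin (5 * v) - 12 * v ^ 3 * sin (6 * v)
      - 88355 / 2016 * v ^ 5 * sin v + 88355 / 4032 * v ^ 5 * sin (3 * v)
      - 17671 / 4032 * v ^ 5 * sin (5 * v) := by
  have hA := hasDerivAt_trig_sum 2 (-4) 4 (-2) 0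
  have hp := hasDerivAt_trig_sum 0 (2 * b3) (2 * b2) (2 * b1) b0
  obtain ⟨e₁, e₂, e₃⟩ := iteratedDeriv_add_sq_mul
    (fun x => (hA x).1) (fun x => (hA x).2.1) (fun x => (hA x).2.2)
    (fun x => (hp x).1) (fun x => (hp x).2.1) (fun x => (hp x).2.2)
  have hN : (fun w => N w b0 b1 b2 b3) = fun x =>
      (2 * cos (4 * x) + -4 * cos (3 * x) + 4 * cos (2 * x) + -2 * cos x + 0) + x ^ 2 *
        (0 * cos (4 * x) + 2 * b3 * cos (3 * x) + 2 * b2 * cos (2 * x) + 2 * b1 * cos x + b0) := by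
    funext x
    rw [N_eq_cos_multiples]
    ring
  rw [hN, e₁] at h₁
  rw [hN, e₂] at h₂
  rw [hN, e₃] at h₃
  replace h₀ := (congrFun hN v).symm.trans h₀
  obtain ⟨c2, c3, c4, c5, c6, s2, s3, s4, s5, s6⟩ := sin_cos_multiples v
  simp only [c2, c3, c4, s2, s3, s4] at h₀ h₁ h₂ h₃
  rw [c2, c3, c4, c5, c6, s2, s3, s4, s5, s6]
  have hs := sin_sq_add_cos_sq v
  generalize sin v = s at *
  generalize cos v = c at *
  have hs2 : s ^ 2 = 1 - c ^ 2 := by linear_combination hs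
  have hs3 : s ^ 3 = s * (1 - c ^ 2) := by rw [← hs2]; ring
  have hs5 : s ^ 5 = s * (1 - c ^ 2) ^ 2 := by rw [← hs2]; ring
  linear_combination (norm := skip)
    (24 * s ^ 2 + 18 * c * s * v + 2 * (3 * c ^ 2 + s ^ 2) * v ^ 2) * h₀
      - (18 * s ^ 2 * v + 12 * c * s * v ^ 2 + (3 * c ^ 2 + s ^ 2) * v ^ 3) * h₁
      + (6 * s ^ 2 * v ^ 2 + 3 * c * s * v ^ 3) * h₂ - s ^ 2 * v ^ 3 * h₃
  ring_nf
  rw [hs5, hs3, hs2]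
  ring

/-- The second-order Taylor coefficient at `v = 0` of the `b3` coefficient of
the method with zero phase-lag and zero first, second and third derivatives
of the phase-lag is `-45767/181440`. -/
theorem b3_zero_PL_three_derivs_second_taylor_coeff
    (δ : ℝ) (hδ : 0 < δ) (b0 b1 b2 b3 : ℝ → ℝ)
    (hcond : ∀ v : ℝ, 0 < |v| → |v| < δ →
      N v (b0 v) (b1 v) (b2 v) (b3 v) = 0 ∧
      deriv (fun w => N w (b0 v) (b1 v) (b2 v) (b3 v)) v = 0 ∧
      iteratedDeriv 2 (fun w => N w (b0 v) (b1 v) (b2 v) (b3 v)) v = 0 ∧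
      iteratedDeriv 3 (fun w => N w (b0 v) (b1 v) (b2 v) (b3 v)) v = 0) :
    Filter.Tendsto (fun v : ℝ => (b3 v - 17671 / 12096) / v ^ 2)
      (nhdsWithin 0 {(0 : ℝ)}ᶜ) (nhds (-45767 / 181440)) := by
  obtain ⟨ρ, hρ, hρ0, hcos⟩ := exists_cos_remainder
  obtain ⟨σ, hσ, hσ0, hsin⟩ := exists_sin_remainder
  set r : ℝ → ℝ := fun v =>
    -45767 / 3780 - 236981821 / 7983360 * v ^ 2 + 4011317 / 762048 * v ^ 4
      - 12 * ρ v - 147456 * ρ (2 * v) + 19131876 * ρ (3 * v) - 5859375000 * ρ (5 * v)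
      + 26121388032 * ρ (6 * v) - 36 * v * σ v - 110592 * v * σ (2 * v)
      + 57395628 * v * σ (3 * v) - 905969664 * v * σ (4 * v) - 8789062500 * v * σ (5 * v)
      + 58773123072 * v * σ (6 * v) + 107 * v ^ 2 * ρ v - 172032 * v ^ 2 * ρ (2 * v)
      - 49424013 * v ^ 2 * ρ (3 * v) + 1409286144 * v ^ 2 * ρ (4 * v)
      + 5371093750 * v ^ 2 * ρ (5 * v) - 56596340736 * v ^ 2 * ρ (6 * v) + 60 * v ^ 3 * σ v
      - 245760 * v ^ 3 * σ (2 * v) - 15943230 * v ^ 3 * σ (3 * v)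
      + 805306368 * v ^ 3 * σ (4 * v) + 1464843750 * v ^ 3 * σ (5 * v)
      - 26121388032 * v ^ 3 * σ (6 * v) - 88355 / 2016 * v ^ 5 * σ v
      + 5217274395 / 448 * v ^ 5 * σ (3 * v) - 4314208984375 / 4032 * v ^ 5 * σ (5 * v) with hr
  have hnum : Tendsto r (𝓝 0) (𝓝 (-45767 / 3780)) := by
    have hcont : Continuous r := by unfold r; fun_prop
    simpa [hr, hρ0, hσ0] using hcont.tendsto 0
  have hden : Tendsto (fun v : ℝ => 48 * sinc v ^ 5) (𝓝 0) (𝓝 48) := by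
    simpa using ((continuous_sinc.tendsto 0).pow 5).const_mul 48
  have hlim := (hnum.div hden (by norm_num)).mono_left (nhdsWithin_le_nhds (s := {0}ᶜ))
  rw [show (-45767 / 3780 / 48 : ℝ) = -45767 / 181440 by norm_num] at hlim
  refine hlim.congr' ?_
  have hball : ∀ᶠ v : ℝ in 𝓝[≠] 0, |v| < δ := nhdsWithin_le_nhds <|
    continuous_abs.continuousAt.eventually_lt continuousAt_const (by simpa)
  have hsinc : ∀ᶠ v : ℝ in 𝓝[≠] 0, sinc v ≠ 0 := nhdsWithin_le_nhds <|
    continuous_sinc.continuousAt.eventually_ne (by simp)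
  filter_upwards [hball, hsinc, self_mem_nhdsWithin] with v hv hsinc0 (hv0 : v ≠ 0)
  obtain ⟨h₀, h₁, h₂, h₃⟩ := hcond v (abs_pos.mpr hv0) hv
  have key := b3_sub_mul_eq_trig_sum h₀ h₁ h₂ h₃
  have hsin_eq : sin v = v * sinc v := by rw [sinc_of_ne_zero hv0]; field_simp
  have hser : 48 * (b3 v - 17671 / 12096) * v ^ 5 * sin v ^ 5 = v ^ 12 * r v := by
    rw [key]
    simp only [hcos, hsin, hr]
    ring
  rw [hsin_eq] at hser
  simp only [Pi.div_apply]
  rw [div_eq_div_iff (by positivity) (by positivity)]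
  refine mul_left_cancel₀ (pow_ne_zero 10 hv0) ?_
  linear_combination -hser
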